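/- The two-way atomic decomposition does not preserve termination of the restricted chase: the rule set 𝓡 = {P(x,y) → ∃z.(P(y,z) ∧ P(z,y))} belongs to CT_R^∀, but 2ad(𝓡) does not belong to CT_R^∀; in particular the knowledge base ⟨2ad(𝓡), {P(a,b)}⟩ admits an infinite fair R-derivation. -/

import Mathlib

namespace ExRules

open scoped Classical

noncomputable section

/-- Terms: constants or variables, each indexed by a natural number. -/
inductive Term where
  | const : ℕ → Term
  | var : ℕ → Term
deriving DecidableEq

/-- An atom: a predicate symbol applied to a list of terms (the arity of the
predicate is the length of the argument list). -/
structure Atom where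
  pred : ℕ
  args : List Term
deriving DecidableEq

/-- A factbase is a finite set of atoms. -/
abbrev FactBase := Finset Atom

/-- A substitution: a map on variables (extended by the identity on constants). -/
abbrev Subst := ℕ → Term

def applyTerm (σ : Subst) : Term → Term
  | .const c => .const c
  | .var v => σ v

def Atom.subst (σ : Subst) (a : Atom) : Atom := ⟨a.pred, a.args.map (applyTerm σ)⟩

def Term.vars : Term → Finset ℕ
  | .const _ => ∅
  | .var v => {v}

def Atom.vars (a : Atom) : Finset ℕ := a.args.foldr (fun t s => t.vars ∪ s) ∅

def FactBase.vars (F : FactBase) : Finset ℕ := F.sup Atom.vars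

/-- The variables occurring in a (possibly infinite) set of atoms. -/
def setVars (S : Set Atom) : Set ℕ := {v | ∃ a ∈ S, v ∈ a.vars}

/-- `σ` is a homomorphism from the atom set `S` to the atom set `S'`. -/
def IsHom (σ : Subst) (S S' : Set Atom) : Prop := ∀ a ∈ S, a.subst σ ∈ S'

/-- A retraction is a homomorphism that is the identity on the common variables. -/
def IsRetraction (σ : Subst) (S S' : Set Atom) : Prop :=
  IsHom σ S S' ∧ ∀ v, v ∈ setVars S → v ∈ setVars S' → σ v = Term.var v

/-- An existential rule `B → ∃z.H` with nonempty body and head.  The frontier and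
the existential variables are determined by the variables shared between body and
head. -/
structure Rule where
  body : Finset Atom
  head : Finset Atom
  body_nonempty : body.Nonempty
  head_nonempty : head.Nonempty

instance : DecidableEq Rule := fun R S =>
  decidable_of_iff (R.body = S.body ∧ R.head = S.head) (by
    constructor
    · rintro ⟨h1, h2⟩
      cases R; cases S; simp_all
    · rintro rfl; exact ⟨rfl, rfl⟩)

/-- The frontier of a rule: the variables shared by body and head. -/
def Rule.frontier (R : Rule) : Finset ℕ := FactBase.vars R.body ∩ FactBase.vars R.head

/-- The existential variables of a rule: head variables not occurring in the body. -/
def Rule.exVars (R : Rule) : Finset ℕ := FactBase.vars R.head \ FactBase.vars R.body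

/-- A rule is Datalog if it has no existential variable. -/
def Rule.IsDatalog (R : Rule) : Prop := R.exVars = ∅

/-- A rule has an atomic head if its head is a single atom. -/
def Rule.IsAtomicHead (R : Rule) : Prop := R.head.card = 1

/-- A rule set is a finite set of existential rules. -/
abbrev RuleSet := Finset Rule

instance : Encodable Term :=
  Encodable.ofEquiv (ℕ ⊕ ℕ)
    { toFun := fun t => match t with | .const c => .inl c | .var v => .inr v
      invFun := fun s => match s with | .inl c => .const c | .inr v => .var v
      left_inv := by intro t; cases t <;> rfl
      right_inv := by intro s; cases s <;> rfl }

instance : Encodable Atom :=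
  Encodable.ofEquiv (ℕ × List Term)
    { toFun := fun a => (a.pred, a.args)
      invFun := fun p => ⟨p.1, p.2⟩
      left_inv := fun _ => rfl
      right_inv := fun _ => rfl }

instance : Encodable Rule :=
  Encodable.ofEquiv {p : Finset Atom × Finset Atom // p.1.Nonempty ∧ p.2.Nonempty}
    { toFun := fun R => ⟨(R.body, R.head), R.body_nonempty, R.head_nonempty⟩
      invFun := fun p => ⟨p.1.1, p.1.2, p.2.1, p.2.2⟩
      left_inv := fun _ => rfl
      right_inv := fun _ => rfl }

/-- A trigger `(R, π)`: a rule together with a substitution. -/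
structure Trigger where
  rule : Rule
  map : Subst

/-- The canonical fresh variable `z_t` associated to a trigger `t` and an
existential variable `z`: it is unique for `z` and (the relevant part of) `t`. -/
def Trigger.freshVar (t : Trigger) (z : ℕ) : ℕ :=
  Nat.pair
    (Encodable.encode (t.rule, ((FactBase.vars t.rule.body).sort (· ≤ ·)).map t.map)) z

/-- The extension `π_R` of the substitution of a trigger, mapping each existential
variable `z` to the fresh variable `z_t`. -/
def Trigger.ext (t : Trigger) : Subst := fun v =>
  if v ∈ t.rule.exVars then Term.var (t.freshVar v) else t.map v

/-- The output of a trigger: `out(t) = π_R(H)`. -/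
def Trigger.out (t : Trigger) : Finset Atom := t.rule.head.image (Atom.subst t.ext)

/-- `t` is a trigger on the factbase `F`: its substitution is a homomorphism from
the body of its rule to `F`. -/
def Trigger.IsOn (t : Trigger) (F : FactBase) : Prop := IsHom t.map ↑t.rule.body ↑F

/-- The chase variants: oblivious, semi-oblivious, restricted, equivalent. -/
inductive Variant where
  | O | SO | R | E

/-- Applicability of a trigger on a factbase, for each chase variant. -/
def Applicable : Variant → Trigger → FactBase → Prop
  | .O, t, F => ¬ t.out ⊆ F
  | .SO, t, F => ∀ t' : Trigger, t'.rule = t.rule →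
      (∀ v ∈ t.rule.frontier, t'.map v = t.map v) → ¬ t'.out ⊆ F
  | .R, t, F => ¬ ∃ σ : Subst, IsRetraction σ ↑(F ∪ t.out) ↑F
  | .E, t, F => ¬ ∃ σ : Subst, IsHom σ ↑(F ∪ t.out) ↑F

/-- An atom set `M` satisfies a rule `B → ∃z.H` if every homomorphism from `B`
to `M` extends to a homomorphism mapping `H` into `M`. -/
def SatisfiesRule (M : Set Atom) (R : Rule) : Prop :=
  ∀ σ : Subst, IsHom σ ↑R.body M →
    ∃ σ' : Subst, (∀ v ∈ FactBase.vars R.body, σ' v = σ v) ∧ IsHom σ' ↑R.head M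

/-- A (finite or infinite) derivation from the knowledge base `⟨𝓡, F⟩`:
`len` is the number of triggers (possibly `⊤`), `fb i` is the `i`-th factbase and,
for `i < len`, `tr i` is the trigger producing `fb (i+1)` from `fb i`. -/
structure Derivation (𝓡 : RuleSet) (F : FactBase) where
  len : ℕ∞
  fb : ℕ → FactBase
  tr : ℕ → Trigger
  fb_zero : fb 0 = F
  rule_mem : ∀ i : ℕ, (i : ℕ∞) < len → (tr i).rule ∈ 𝓡
  trig_on : ∀ i : ℕ, (i : ℕ∞) < len → (tr i).IsOn (fb i)
  trig_new : ∀ i : ℕ, (i : ℕ∞) < len → ¬ (tr i).out ⊆ fb i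
  fb_succ : ∀ i : ℕ, (i : ℕ∞) < len → fb (i + 1) = fb i ∪ (tr i).out
  fb_stall : ∀ i : ℕ, ¬ (i : ℕ∞) < len → fb (i + 1) = fb i

namespace Derivation

variable {𝓡 : RuleSet} {F : FactBase}

/-- An `X`-derivation: every applied trigger is `X`-applicable when applied. -/
def IsX (X : Variant) (D : Derivation 𝓡 F) : Prop :=
  ∀ i : ℕ, (i : ℕ∞) < D.len → Applicable X (D.tr i) (D.fb i)

/-- Datalog-first: a non-Datalog rule is only applied when all Datalog rules of
the rule set are satisfied. -/
def DatalogFirst (D : Derivation 𝓡 F) : Prop :=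
  ∀ i : ℕ, (i : ℕ∞) < D.len → ¬ (D.tr i).rule.IsDatalog →
    ∀ R ∈ 𝓡, R.IsDatalog → SatisfiesRule ↑(D.fb i) R

/-- Fairness: every trigger `X`-applicable on some factbase of the derivation is
eventually not `X`-applicable. -/
def Fair (X : Variant) (D : Derivation 𝓡 F) : Prop :=
  ∀ i : ℕ, (i : ℕ∞) ≤ D.len → ∀ t : Trigger, t.rule ∈ 𝓡 → t.IsOn (D.fb i) →
    Applicable X t (D.fb i) →
    ∃ j : ℕ, i < j ∧ (j : ℕ∞) ≤ D.len ∧ ¬ Applicable X t (D.fb j)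

/-- A derivation is finite if its length is not `⊤`. -/
def Finite (D : Derivation 𝓡 F) : Prop := D.len ≠ ⊤

end Derivation

/-- `CT_X^∀` (non-Datalog-first): every fair `X`-derivation from every KB is finite. -/
def CTall (X : Variant) (𝓡 : RuleSet) : Prop :=
  ∀ F : FactBase, ∀ D : Derivation 𝓡 F, D.IsX X → D.Fair X → D.Finite

/-- `CT_X^∃`: some fair `X`-derivation from every KB is finite. -/
def CTex (X : Variant) (𝓡 : RuleSet) : Prop :=
  ∀ F : FactBase, ∃ D : Derivation 𝓡 F, D.IsX X ∧ D.Fair X ∧ D.Finite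

/-- `CT_{df-X}^∀`: every fair Datalog-first `X`-derivation from every KB is finite. -/
def CTallDF (X : Variant) (𝓡 : RuleSet) : Prop :=
  ∀ F : FactBase, ∀ D : Derivation 𝓡 F, D.IsX X → D.DatalogFirst → D.Fair X → D.Finite

/-- `CT_{df-X}^∃`: some fair Datalog-first `X`-derivation from every KB is finite. -/
def CTexDF (X : Variant) (𝓡 : RuleSet) : Prop :=
  ∀ F : FactBase, ∃ D : Derivation 𝓡 F, D.IsX X ∧ D.DatalogFirst ∧ D.Fair X ∧ D.Finite

/-! ### Single-piece decomposition -/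

/-- Adjacency in the piece graph of a rule: two head atoms sharing an existential
variable. -/
def PieceAdj (R : Rule) (a b : Atom) : Prop :=
  a ∈ R.head ∧ b ∈ R.head ∧ (a.vars ∩ b.vars ∩ R.exVars).Nonempty

/-- The piece (connected component of the piece graph) containing a given head atom. -/
def pieceOf (R : Rule) (a : Atom) : Finset Atom :=
  R.head.filter fun b => Relation.ReflTransGen (PieceAdj R) a b

theorem self_mem_pieceOf {R : Rule} {a : Atom} (h : a ∈ R.head) : a ∈ pieceOf R a := by
  rw [pieceOf, Finset.mem_filter]
  exact ⟨h, Relation.ReflTransGen.refl⟩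

/-- The single-piece decomposition of a rule. -/
def Rule.sp (R : Rule) : Finset Rule :=
  R.head.attach.image fun a =>
    ⟨R.body, pieceOf R a.1, R.body_nonempty, ⟨a.1, self_mem_pieceOf a.2⟩⟩

/-- The single-piece decomposition of a rule set. -/
def spSet (𝓡 : RuleSet) : RuleSet := 𝓡.biUnion Rule.sp

/-! ### Atomic decompositions -/

/-- The predicates occurring in a rule set. -/
def RuleSet.predsF (𝓡 : RuleSet) : Finset ℕ :=
  𝓡.sup fun R => (R.body.image Atom.pred) ∪ (R.head.image Atom.pred)

/-- A fresh predicate `X_R`, unique for `R` and not occurring in `𝓡`. -/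
def freshPred (𝓡 : RuleSet) (R : Rule) : ℕ :=
  (RuleSet.predsF 𝓡).sup id + 1 + Encodable.encode R

/-- The atom `X_R(x, z)` over the fresh predicate, whose arguments are the frontier
variables followed by the existential variables of `R`. -/
def xAtom (𝓡 : RuleSet) (R : Rule) : Atom :=
  ⟨freshPred 𝓡 R,
    ((R.frontier.sort (· ≤ ·)).map Term.var) ++ ((R.exVars.sort (· ≤ ·)).map Term.var)⟩

/-- The one-way atomic decomposition of a rule `R = B → ∃z.H` (relative to `𝓡`):
the rule `B → ∃z.X_R(x,z)` together with a rule `X_R(x,z) → P(t)` for each head atom. -/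
def oneAdRule (𝓡 : RuleSet) (R : Rule) : Finset Rule :=
  insert ⟨R.body, {xAtom 𝓡 R}, R.body_nonempty, Finset.singleton_nonempty _⟩
    (R.head.attach.image fun a =>
      ⟨{xAtom 𝓡 R}, {a.1}, Finset.singleton_nonempty _, Finset.singleton_nonempty _⟩)

/-- The one-way atomic decomposition of a rule set. -/
def oneAd (𝓡 : RuleSet) : RuleSet := 𝓡.biUnion (oneAdRule 𝓡)

/-- The two-way atomic decomposition: `2ad(R) = 1ad(R) ∪ {H[x,z] → X_R(x,z)}`. -/
def twoAd (𝓡 : RuleSet) : RuleSet :=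
  oneAd 𝓡 ∪ 𝓡.image fun R =>
    ⟨R.head, {xAtom 𝓡 R}, R.head_nonempty, Finset.singleton_nonempty _⟩

/-! ### Models, entailment, BDDP -/

/-- `M` is a model of the rule set `𝓡`. -/
def IsModelOfRules (𝓡 : RuleSet) (M : Set Atom) : Prop := ∀ R ∈ 𝓡, SatisfiesRule M R

/-- `M` is a model of the knowledge base `⟨𝓡, F⟩`. -/
def IsModelOfKB (𝓡 : RuleSet) (F : FactBase) (M : Set Atom) : Prop :=
  IsModelOfRules 𝓡 M ∧ ∃ σ : Subst, IsHom σ ↑F M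

/-- `M` is a universal model of `⟨𝓡, F⟩`: a model mapping homomorphically into
every model. -/
def IsUniversalModel (𝓡 : RuleSet) (F : FactBase) (M : Set Atom) : Prop :=
  IsModelOfKB 𝓡 F M ∧ ∀ N : Set Atom, IsModelOfKB 𝓡 F N → ∃ σ : Subst, IsHom σ M N

/-- An atom set entails a Boolean conjunctive query `Q` if `Q` maps
homomorphically into it. -/
def EntailsQ (S : Set Atom) (Q : Finset Atom) : Prop := ∃ σ : Subst, IsHom σ ↑Q S

/-- `⟨𝓡, F⟩ ⊨ Q`: every model of the KB entails `Q`. -/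
def KBEntails (𝓡 : RuleSet) (F : FactBase) (Q : Finset Atom) : Prop :=
  ∀ M : Set Atom, IsModelOfKB 𝓡 F M → EntailsQ M Q

/-- `R(F)`: the minimal atom set including `F` and `out(t)` for every trigger `t`
with rule `R` on `F`. -/
def ruleStep (R : Rule) (S : Set Atom) : Set Atom :=
  S ∪ {a | ∃ t : Trigger, t.rule = R ∧ IsHom t.map ↑R.body S ∧ a ∈ t.out}

/-- `𝓡(F) = ⋃_{R ∈ 𝓡} R(F)` (together with `F`). -/
def setStep (𝓡 : RuleSet) (S : Set Atom) : Set Atom := S ∪ ⋃ R ∈ 𝓡, ruleStep R S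

/-- The breadth-first chase `Ch_i(⟨𝓡, F⟩)`. -/
def ch (𝓡 : RuleSet) (F : FactBase) : ℕ → Set Atom
  | 0 => ↑F
  | i + 1 => setStep 𝓡 (ch 𝓡 F i)

/-- The bounded derivation depth property. -/
def BDDP (𝓡 : RuleSet) : Prop :=
  ∀ Q : Finset Atom, ∃ k : ℕ, ∀ F : FactBase, KBEntails 𝓡 F Q ↔ EntailsQ (ch 𝓡 F k) Q

/-! ### Conservative extensions -/

/-- The restriction of an atom set to the atoms over a given set of predicates. -/
def restrictTo (M : Set Atom) (P : Set ℕ) : Set Atom := {a ∈ M | a.pred ∈ P}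

/-- The terms (domain elements) of an atom set. -/
def termsOf (M : Set Atom) : Set Term := {u | ∃ a ∈ M, u ∈ a.args}

/-- `𝓡'` is a conservative extension of `𝓡`. -/
def ConservativeExt (𝓡 𝓡' : RuleSet) : Prop :=
  (↑(RuleSet.predsF 𝓡) : Set ℕ) ⊆ ↑(RuleSet.predsF 𝓡') ∧
  (∀ M : Set Atom, IsModelOfRules 𝓡' M →
    IsModelOfRules 𝓡 (restrictTo M ↑(RuleSet.predsF 𝓡))) ∧
  (∀ M : Set Atom, IsModelOfRules 𝓡 M →
    ∃ M' : Set Atom, M ⊆ M' ∧ IsModelOfRules 𝓡' M' ∧ termsOf M' = termsOf M ∧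
      restrictTo M' ↑(RuleSet.predsF 𝓡) = restrictTo M ↑(RuleSet.predsF 𝓡))

/-- `𝓡'` is a universal-conservative extension of `𝓡`. -/
def UnivConservativeExt (𝓡 𝓡' : RuleSet) : Prop :=
  (↑(RuleSet.predsF 𝓡) : Set ℕ) ⊆ ↑(RuleSet.predsF 𝓡') ∧
  ∀ F : FactBase, (∀ a ∈ F, a.pred ∈ RuleSet.predsF 𝓡) →
    (∀ M : Set Atom, IsUniversalModel 𝓡' F M →
      IsUniversalModel 𝓡 F (restrictTo M ↑(RuleSet.predsF 𝓡))) ∧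
    (∀ M : Set Atom, IsUniversalModel 𝓡 F M →
      ∃ M' : Set Atom, M ⊆ M' ∧ IsUniversalModel 𝓡' F M' ∧ termsOf M' = termsOf M ∧
        restrictTo M' ↑(RuleSet.predsF 𝓡) = restrictTo M ↑(RuleSet.predsF 𝓡))

def aP (t u : Term) : Atom := ⟨0, [t, u]⟩
def vx : Term := Term.var 0
def vy : Term := Term.var 1
def vz : Term := Term.var 2

/-- `𝓡₀ = {P(x,y) → ∃z.(P(y,z) ∧ P(z,y))}`. -/
def R0set : RuleSet :=
  { ⟨{aP vx vy}, {aP vy vz, aP vz vy},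
      Finset.singleton_nonempty _, Finset.insert_nonempty _ _⟩ }

/-- The factbase `{P(a,b)}`. -/
def Fab : FactBase := {aP (Term.const 0) (Term.const 1)}

/-! ### Substitutions and applicability -/

theorem Atom.mem_vars {a : Atom} {v : ℕ} : v ∈ a.vars ↔ Term.var v ∈ a.args := by
  obtain ⟨p, l⟩ := a
  simp only [Atom.vars]
  induction l with
  | nil => simp
  | cons t l ih =>
    rw [List.foldr_cons, Finset.mem_union, ih, List.mem_cons]
    cases t <;> simp [Term.vars]

theorem Atom.subst_eq_self {σ : Subst} {a : Atom} (h : ∀ v ∈ a.vars, σ v = Term.var v) :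
    a.subst σ = a := by
  obtain ⟨p, l⟩ := a
  simp only [Atom.subst, Atom.mk.injEq, true_and]
  refine (List.map_congr_left fun t ht => ?_).trans (List.map_id l)
  cases t with
  | const c => rfl
  | var v => exact h v (Atom.mem_vars.2 ht)

theorem finite_setVars (F : FactBase) : (setVars (↑F : Set Atom)).Finite := by
  refine (F.biUnion Atom.vars).finite_toSet.subset ?_
  rintro v ⟨a, ha, hv⟩
  simpa using ⟨a, ha, hv⟩

theorem not_applicable_of_subst {t : Trigger} {F : FactBase} (σ : Subst)
    (hfix : ∀ v ∈ setVars (↑F : Set Atom), σ v = Term.var v)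
    (hout : ∀ a ∈ t.out, a.subst σ ∈ F) : ¬ Applicable .R t F := by
  refine not_not.2 ⟨σ, fun a ha => ?_, fun v _ hv => hfix v hv⟩
  rcases Finset.mem_union.1 (Finset.mem_coe.1 ha) with ha | ha
  · rw [Atom.subst_eq_self fun v hv => hfix v ⟨a, ha, hv⟩]
    exact ha
  · exact hout a ha

theorem not_applicable_of_out_subset {t : Trigger} {F : FactBase} (h : t.out ⊆ F) :
    ¬ Applicable .R t F :=
  not_applicable_of_subst Term.var (fun _ _ => rfl) fun a ha => by
    rw [Atom.subst_eq_self fun _ _ => rfl]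
    exact h ha

theorem IsRetraction.applyTerm_eq {σ : Subst} {F G : FactBase}
    (h : IsRetraction σ ↑(F ∪ G) ↑F) {a : Atom} (ha : a ∈ F) {t : Term} (ht : t ∈ a.args) :
    applyTerm σ t = t := by
  cases t with
  | const c => rfl
  | var v =>
    have hv := Atom.mem_vars.2 ht
    exact h.2 v ⟨a, by simp [ha], hv⟩ ⟨a, ha, hv⟩

theorem Trigger.freshVar_inj {t t' : Trigger} {z z' : ℕ} (h : t.freshVar z = t'.freshVar z') :
    t.rule = t'.rule ∧ ∀ v ∈ FactBase.vars t.rule.body, t.map v = t'.map v := by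
  have h1 := Encodable.encode_injective (Nat.pair_eq_pair.1 h).1
  obtain ⟨hr, hm⟩ := Prod.mk.inj h1
  refine ⟨hr, fun v hv => ?_⟩
  rw [← hr] at hm
  exact List.map_inj_left.1 hm v (by simpa using hv)

theorem Derivation.fb_mono {𝓡 : RuleSet} {F : FactBase} (D : Derivation 𝓡 F) : Monotone D.fb := by
  refine monotone_nat_of_le_succ fun i => ?_
  by_cases h : (i : ℕ∞) < D.len
  · rw [D.fb_succ i h]
    exact Finset.subset_union_left
  · rw [D.fb_stall i h]

/-! ### Termination for the original rule -/

/-- The rule `P(x,y) → ∃z.(P(y,z) ∧ P(z,y))`. -/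
def symRule : Rule :=
  ⟨{aP vx vy}, {aP vy vz, aP vz vy}, Finset.singleton_nonempty _, Finset.insert_nonempty _ _⟩

theorem R0set_eq : R0set = {symRule} := rfl

theorem vars_symRule_body : FactBase.vars symRule.body = {0, 1} := by
  simp [FactBase.vars, symRule, aP, vx, vy, Atom.vars, Term.vars]

theorem vars_symRule_head : FactBase.vars symRule.head = {1, 2} := by
  simp [FactBase.vars, symRule, aP, vz, vy, Atom.vars, Term.vars]
  decide

theorem exVars_symRule : symRule.exVars = {2} := by
  rw [Rule.exVars, vars_symRule_body, vars_symRule_head]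
  decide

theorem frontier_symRule : symRule.frontier = {1} := by
  rw [Rule.frontier, vars_symRule_body, vars_symRule_head]
  decide

theorem out_symRule {t : Trigger} (h : t.rule = symRule) :
    t.out = {aP (t.map 1) (.var (t.freshVar 2)), aP (.var (t.freshVar 2)) (t.map 1)} := by
  have h1 : t.ext 1 = t.map 1 := by simp [Trigger.ext, h, exVars_symRule]
  have h2 : t.ext 2 = .var (t.freshVar 2) := by simp [Trigger.ext, h, exVars_symRule]
  rw [Trigger.out, h]
  simp [symRule, Atom.subst, aP, vy, vz, applyTerm, h1, h2]

theorem isOn_symRule {t : Trigger} (h : t.rule = symRule) {F : FactBase} (ht : t.IsOn F) :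
    aP (t.map 0) (t.map 1) ∈ F := by
  have := ht (aP vx vy) (by simp [h, symRule])
  simpa [Atom.subst, aP, vx, vy, applyTerm] using this

theorem not_applicable_symRule {t : Trigger} (h : t.rule = symRule) {F : FactBase}
    (hz : t.freshVar 2 ∉ setVars (↑F : Set Atom)) {w : Term}
    (h1 : aP (t.map 1) w ∈ F) (h2 : aP w (t.map 1) ∈ F) : ¬ Applicable .R t F := by
  have hfix : ∀ v ∈ setVars (↑F : Set Atom),
      Function.update Term.var (t.freshVar 2) w v = Term.var v := fun v hv =>
    Function.update_of_ne (by rintro rfl; exact hz hv) _ _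
  refine not_applicable_of_subst _ hfix fun a ha => ?_
  have hy : applyTerm (Function.update Term.var (t.freshVar 2) w) (t.map 1) = t.map 1 := by
    cases hm : t.map 1 with
    | const c => rfl
    | var v => exact hfix v ⟨_, h1, Atom.mem_vars.2 (by simp [aP, hm])⟩
  have hw : applyTerm (Function.update Term.var (t.freshVar 2) w) (.var (t.freshVar 2)) = w := by
    simp [applyTerm]
  rw [out_symRule h] at ha
  rcases Finset.mem_insert.1 ha with rfl | ha
  · simpa [Atom.subst, aP, hy, hw] using h1
  · rw [Finset.mem_singleton.1 ha]
    simpa [Atom.subst, aP, hy, hw] using h2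

theorem ctall_R0set : CTall .R R0set := by
  intro F D hX _ hlen
  have hlt : ∀ i : ℕ, (i : ℕ∞) < D.len := fun i => hlen ▸ ENat.natCast_lt_top i
  have hr : ∀ i, (D.tr i).rule = symRule := fun i => by
    simpa [R0set_eq] using D.rule_mem i (hlt i)
  have hbody : ∀ i, aP ((D.tr i).map 0) ((D.tr i).map 1) ∈ D.fb i := fun i =>
    isOn_symRule (hr i) (D.trig_on i (hlt i))
  have hsucc : ∀ i, D.fb (i + 1) = D.fb i ∪ (D.tr i).out := fun i => D.fb_succ i (hlt i)
  have hout : ∀ {i j}, i < j → (D.tr i).out ⊆ D.fb j := fun {i j} hij =>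
    (by rw [hsucc]; exact Finset.subset_union_right : (D.tr i).out ⊆ D.fb (i + 1)).trans
      (D.fb_mono hij)
  have hz : ∀ {i j}, i < j → (D.tr i).freshVar 2 ≠ (D.tr j).freshVar 2 := by
    intro i j hij e
    have hm := (Trigger.freshVar_inj e).2 1 (by rw [hr, vars_symRule_body]; simp)
    refine D.trig_new j (hlt j) ?_
    rw [out_symRule (hr j), ← e, ← hm, ← out_symRule (hr i)]
    exact hout hij
  have hvars : ∀ n, ∀ v ∈ setVars (↑(D.fb n) : Set Atom),
      v ∈ setVars (↑F : Set Atom) ∨ ∃ i < n, v = (D.tr i).freshVar 2 := by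
    intro n
    induction n with
    | zero => intro v hv; rw [D.fb_zero] at hv; exact .inl hv
    | succ n ih =>
      have hy : ∀ v, Term.var v = (D.tr n).map 1 → v ∈ setVars (↑(D.fb n) : Set Atom) :=
        fun v hv => ⟨_, hbody n, Atom.mem_vars.2 (by simp [aP, hv])⟩
      rintro v ⟨a, ha, hv⟩
      have key : v ∈ setVars (↑(D.fb n) : Set Atom) ∨ v = (D.tr n).freshVar 2 := by
        rw [Finset.mem_coe, hsucc, Finset.mem_union, out_symRule (hr n)] at ha
        rcases ha with ha | ha
        · exact .inl ⟨a, ha, hv⟩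
        · rw [Finset.mem_insert, Finset.mem_singleton] at ha
          rw [Atom.mem_vars] at hv
          rcases ha with rfl | rfl <;> simp [aP] at hv <;> rcases hv with hv | hv
          · exact .inl (hy v hv)
          · exact .inr hv
          · exact .inr hv
          · exact .inl (hy v hv)
      rcases key with h | h
      · rcases ih v h with h | ⟨i, hi, h⟩
        · exact .inl h
        · exact .inr ⟨i, by omega, h⟩
      · exact .inr ⟨n, by omega, h⟩
  have hfresh : ∀ j, (D.tr j).freshVar 2 ∉ setVars (↑F : Set Atom) →
      (D.tr j).freshVar 2 ∉ setVars (↑(D.fb j) : Set Atom) := fun j hj hv => by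
    rcases hvars j _ hv with h | ⟨i, hi, h⟩
    · exact hj h
    · exact hz hi h.symm
  have hwit : ∀ n x y, aP x y ∈ D.fb n →
      aP x y ∈ F ∨ ∃ w, aP y w ∈ D.fb n ∧ aP w y ∈ D.fb n := by
    intro n
    induction n with
    | zero => intro x y h; rw [D.fb_zero] at h; exact .inl h
    | succ n ih =>
      intro x y h
      have hsub := D.fb_mono (Nat.le_succ n)
      have ho := hout (Nat.lt_succ_self n)
      rw [hsucc, Finset.mem_union] at h
      rcases h with h | h
      · rcases ih x y h with h | ⟨w, h1, h2⟩
        · exact .inl h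
        · exact .inr ⟨w, hsub h1, hsub h2⟩
      · rw [out_symRule (hr n)] at h ho
        rw [Finset.insert_subset_iff, Finset.singleton_subset_iff] at ho
        rw [Finset.mem_insert, Finset.mem_singleton] at h
        rcases h with h | h <;> simp [aP] at h <;> obtain ⟨rfl, rfl⟩ := h
        · exact .inr ⟨_, ho.2, ho.1⟩
        · exact .inr ⟨_, ho.1, ho.2⟩
  have hA : {j | (D.tr j).freshVar 2 ∈ setVars (↑F : Set Atom)}.Finite := by
    refine Set.Finite.of_injOn (f := fun j => (D.tr j).freshVar 2) (fun j hj => hj) ?_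
      (finite_setVars F)
    intro i _ j _ e
    by_contra hne
    rcases lt_or_gt_of_ne hne with h | h
    · exact hz h e
    · exact hz h e.symm
  have hB : {j | (D.tr j).freshVar 2 ∉ setVars (↑F : Set Atom)}.Finite := by
    have hy : ∀ {i j}, i < j → (D.tr j).freshVar 2 ∉ setVars (↑F : Set Atom) →
        (D.tr i).map 1 ≠ (D.tr j).map 1 := by
      intro i j hij hj e
      have ho := hout hij
      rw [out_symRule (hr i), Finset.insert_subset_iff, Finset.singleton_subset_iff, e] at ho
      exact not_applicable_symRule (hr j) (hfresh j hj) ho.1 ho.2 (hX j (hlt j))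
    refine Set.Finite.of_injOn (f := fun j => aP ((D.tr j).map 0) ((D.tr j).map 1))
      (t := (↑F : Set Atom)) (fun j hj => ?_) ?_ F.finite_toSet
    · rcases hwit j _ _ (hbody j) with h | ⟨w, h1, h2⟩
      · exact h
      · exact absurd (hX j (hlt j)) (not_applicable_symRule (hr j) (hfresh j hj) h1 h2)
    · intro i hi j hj e
      simp [aP] at e
      by_contra hne
      rcases lt_or_gt_of_ne hne with h | h
      · exact hy h hj e.2
      · exact hy h hi e.2.symm
  refine Set.infinite_univ (α := ℕ) ((hA.union hB).subset fun j _ => ?_)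
  exact em _

/-! ### The rules of the two-way atomic decomposition -/

/-- The fresh predicate `X` of the decomposition. -/
def xPred : ℕ := freshPred {symRule} symRule

/-- The atom `X(t,u)`. -/
def aX (t u : Term) : Atom := ⟨xPred, [t, u]⟩

theorem xPred_ne_zero : xPred ≠ 0 := by
  unfold xPred freshPred
  omega

theorem xAtom_symRule : xAtom {symRule} symRule = aX vy vz := by
  simp [xAtom, frontier_symRule, exVars_symRule, aX, xPred, vy, vz]

theorem aP_inj {s t s' t' : Term} : aP s t = aP s' t' ↔ s = s' ∧ t = t' := by simp [aP]

theorem aX_inj {s t s' t' : Term} : aX s t = aX s' t' ↔ s = s' ∧ t = t' := by simp [aX]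

theorem aP_ne_aX {s t s' t' : Term} : aP s t ≠ aX s' t' := fun h =>
  xPred_ne_zero (congrArg Atom.pred h).symm

theorem subst_aP (σ : Subst) (s t : Term) :
    (aP s t).subst σ = aP (applyTerm σ s) (applyTerm σ t) := rfl

theorem subst_aX (σ : Subst) (s t : Term) :
    (aX s t).subst σ = aX (applyTerm σ s) (applyTerm σ t) := rfl

/-- The rule `P(x,y) → ∃z.X(y,z)`. -/
def createRule : Rule :=
  ⟨{aP vx vy}, {aX vy vz}, Finset.singleton_nonempty _, Finset.singleton_nonempty _⟩

/-- The rule `X(y,z) → P(y,z)`. -/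
def forwardRule : Rule :=
  ⟨{aX vy vz}, {aP vy vz}, Finset.singleton_nonempty _, Finset.singleton_nonempty _⟩

/-- The rule `X(y,z) → P(z,y)`. -/
def backwardRule : Rule :=
  ⟨{aX vy vz}, {aP vz vy}, Finset.singleton_nonempty _, Finset.singleton_nonempty _⟩

/-- The rule `P(y,z) ∧ P(z,y) → X(y,z)`. -/
def collectRule : Rule :=
  ⟨{aP vy vz, aP vz vy}, {aX vy vz}, Finset.insert_nonempty _ _, Finset.singleton_nonempty _⟩

theorem mem_twoAd_R0set {R : Rule} : R ∈ twoAd R0set ↔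
    R = createRule ∨ R = forwardRule ∨ R = backwardRule ∨ R = collectRule := by
  have h : symRule.head = {aP vy vz, aP vz vy} := rfl
  have hb : symRule.body = {aP vx vy} := rfl
  simp only [twoAd, oneAd, R0set_eq, Finset.singleton_biUnion, Finset.image_singleton,
    oneAdRule, Finset.mem_union, Finset.mem_insert, Finset.mem_singleton, Finset.mem_image,
    Finset.mem_attach, true_and, Subtype.exists]
  simp only [xAtom_symRule, h, hb, createRule, forwardRule, backwardRule, collectRule]
  constructor
  · rintro ((h | ⟨a, ha, h⟩) | h)
    · exact .inl h
    · rcases Finset.mem_insert.1 ha with rfl | ha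
      · exact .inr (.inl h.symm)
      · obtain rfl := Finset.mem_singleton.1 ha
        exact .inr (.inr (.inl h.symm))
    · exact .inr (.inr (.inr h))
  · rintro (h | h | h | h)
    · exact .inl (.inl h)
    · exact .inl (.inr ⟨aP vy vz, by simp, h.symm⟩)
    · exact .inl (.inr ⟨aP vz vy, by simp, h.symm⟩)
    · exact .inr h

theorem vars_createRule_body : FactBase.vars createRule.body = {0, 1} := vars_symRule_body

theorem exVars_createRule : createRule.exVars = {2} := by
  have : FactBase.vars createRule.head = {1, 2} := by
    simp [FactBase.vars, createRule, aX, vz, vy, Atom.vars, Term.vars]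
  rw [Rule.exVars, vars_createRule_body, this]
  decide

theorem exVars_forwardRule : forwardRule.exVars = ∅ := by
  simp [Rule.exVars, forwardRule, FactBase.vars, aX, aP, vz, vy, Atom.vars, Term.vars]

theorem exVars_backwardRule : backwardRule.exVars = ∅ := by
  simp [Rule.exVars, backwardRule, FactBase.vars, aX, aP, vz, vy, Atom.vars, Term.vars]
  decide

theorem exVars_collectRule : collectRule.exVars = ∅ := by
  simp [Rule.exVars, collectRule, FactBase.vars, aX, aP, vz, vy, Atom.vars, Term.vars]
  decide

theorem Trigger.ext_of_isDatalog {t : Trigger} (h : t.rule.exVars = ∅) : t.ext = t.map := by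
  funext v
  simp [Trigger.ext, h]

theorem out_createRule {t : Trigger} (h : t.rule = createRule) :
    t.out = {aX (t.map 1) (.var (t.freshVar 2))} := by
  have h1 : t.ext 1 = t.map 1 := by simp [Trigger.ext, h, exVars_createRule]
  have h2 : t.ext 2 = .var (t.freshVar 2) := by simp [Trigger.ext, h, exVars_createRule]
  rw [Trigger.out, h]
  simp [createRule, subst_aX, vy, vz, applyTerm, h1, h2]

theorem out_forwardRule {t : Trigger} (h : t.rule = forwardRule) :
    t.out = {aP (t.map 1) (t.map 2)} := by
  rw [Trigger.out, Trigger.ext_of_isDatalog (h ▸ exVars_forwardRule), h]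
  simp [forwardRule, subst_aP, vy, vz, applyTerm]

theorem out_backwardRule {t : Trigger} (h : t.rule = backwardRule) :
    t.out = {aP (t.map 2) (t.map 1)} := by
  rw [Trigger.out, Trigger.ext_of_isDatalog (h ▸ exVars_backwardRule), h]
  simp [backwardRule, subst_aP, vy, vz, applyTerm]

theorem out_collectRule {t : Trigger} (h : t.rule = collectRule) :
    t.out = {aX (t.map 1) (t.map 2)} := by
  rw [Trigger.out, Trigger.ext_of_isDatalog (h ▸ exVars_collectRule), h]
  simp [collectRule, subst_aX, vy, vz, applyTerm]

theorem isOn_createRule {t : Trigger} (h : t.rule = createRule) {F : FactBase} :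
    t.IsOn F ↔ aP (t.map 0) (t.map 1) ∈ F := by
  simp [Trigger.IsOn, IsHom, h, createRule, subst_aP, vx, vy, applyTerm]

theorem isOn_forwardRule {t : Trigger} (h : t.rule = forwardRule) {F : FactBase} :
    t.IsOn F ↔ aX (t.map 1) (t.map 2) ∈ F := by
  simp [Trigger.IsOn, IsHom, h, forwardRule, subst_aX, vy, vz, applyTerm]

theorem isOn_backwardRule {t : Trigger} (h : t.rule = backwardRule) {F : FactBase} :
    t.IsOn F ↔ aX (t.map 1) (t.map 2) ∈ F := by
  simp [Trigger.IsOn, IsHom, h, backwardRule, subst_aX, vy, vz, applyTerm]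

theorem isOn_collectRule {t : Trigger} (h : t.rule = collectRule) {F : FactBase} :
    t.IsOn F ↔ aP (t.map 1) (t.map 2) ∈ F ∧ aP (t.map 2) (t.map 1) ∈ F := by
  simp [Trigger.IsOn, IsHom, h, collectRule, subst_aP, vy, vz, applyTerm]

/-! ### The infinite fair derivation -/

/-- The substitution `x ↦ r, y ↦ s, z ↦ t`. -/
def assign (r s t : Term) : Subst
  | 0 => r
  | 1 => s
  | _ => t

/-- The terms of the infinite path `a, b, z₀, z₁, …` built by the derivation. -/
def pathTerm : ℕ → Term
  | 0 => .const 0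
  | 1 => .const 1
  | n + 2 => .var (Trigger.freshVar
      ⟨createRule, assign (pathTerm n) (pathTerm (n + 1)) (.const 0)⟩ 2)

theorem pathTerm_injective : Function.Injective pathTerm := by
  intro n
  induction n with
  | zero =>
    intro m h
    match m with
    | 0 => rfl
    | 1 => simp [pathTerm] at h
    | m + 2 => simp [pathTerm] at h
  | succ n ih =>
    intro m h
    match n, m with
    | 0, 0 => simp [pathTerm] at h
    | 0, 1 => rfl
    | 0, m + 2 => simp [pathTerm] at h
    | n + 1, 0 => simp [pathTerm] at h
    | n + 1, 1 => simp [pathTerm] at h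
    | n + 1, m + 2 =>
      simp only [pathTerm, Term.var.injEq] at h
      have := (Trigger.freshVar_inj h).2 1 (by rw [vars_createRule_body]; simp)
      exact congrArg _ (ih this)

theorem pathTerm_eq {n m : ℕ} : pathTerm n = pathTerm m ↔ n = m := pathTerm_injective.eq_iff

/-- The atom `P(uᵢ,uⱼ)` over the path. -/
def pathP (i j : ℕ) : Atom := aP (pathTerm i) (pathTerm j)

/-- The atom `X(uᵢ,uⱼ)` over the path. -/
def pathX (i j : ℕ) : Atom := aX (pathTerm i) (pathTerm j)

/-- The atoms in the order in which the derivation produces them. -/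
def atomSeq : ℕ → Atom
  | 0 => pathP 0 1
  | 1 => pathX 1 2
  | n + 2 =>
    match n % 4 with
    | 0 => pathP (n / 4 + 1) (n / 4 + 2)
    | 1 => pathX (n / 4 + 2) (n / 4 + 3)
    | 2 => pathP (n / 4 + 2) (n / 4 + 1)
    | _ => pathX (n / 4 + 2) (n / 4 + 1)

/-- The triggers of the derivation. -/
def trigSeq : ℕ → Trigger
  | 0 => ⟨createRule, assign (pathTerm 0) (pathTerm 1) (.const 0)⟩
  | n + 1 =>
    match n % 4 with
    | 0 => ⟨forwardRule, assign (.const 0) (pathTerm (n / 4 + 1)) (pathTerm (n / 4 + 2))⟩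
    | 1 => ⟨createRule, assign (pathTerm (n / 4 + 1)) (pathTerm (n / 4 + 2)) (.const 0)⟩
    | 2 => ⟨backwardRule, assign (.const 0) (pathTerm (n / 4 + 1)) (pathTerm (n / 4 + 2))⟩
    | _ => ⟨collectRule, assign (.const 0) (pathTerm (n / 4 + 2)) (pathTerm (n / 4 + 1))⟩

/-- The factbases of the derivation. -/
def fbSeq (i : ℕ) : FactBase := (Finset.range (i + 1)).image atomSeq

theorem block_cases (i : ℕ) : i = 0 ∨ i = 1 ∨
    ∃ k, i = 4 * k + 2 ∨ i = 4 * k + 3 ∨ i = 4 * k + 4 ∨ i = 4 * k + 5 := by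
  rcases Nat.lt_or_ge i 2 with h | h
  · omega
  · exact .inr (.inr ⟨(i - 2) / 4, by omega⟩)

theorem atomSeq_block (k : ℕ) :
    atomSeq (4 * k + 2) = pathP (k + 1) (k + 2) ∧ atomSeq (4 * k + 3) = pathX (k + 2) (k + 3) ∧
    atomSeq (4 * k + 4) = pathP (k + 2) (k + 1) ∧ atomSeq (4 * k + 5) = pathX (k + 2) (k + 1) := by
  have e0 : (4 * k) % 4 = 0 ∧ (4 * k) / 4 = k := by omega
  have e1 : (4 * k + 1) % 4 = 1 ∧ (4 * k + 1) / 4 = k := by omega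
  have e2 : (4 * k + 2) % 4 = 2 ∧ (4 * k + 2) / 4 = k := by omega
  have e3 : (4 * k + 3) % 4 = 3 ∧ (4 * k + 3) / 4 = k := by omega
  simp only [atomSeq, e0, e1, e2, e3, and_self]

theorem trigSeq_block (k : ℕ) :
    trigSeq (4 * k + 1) = ⟨forwardRule, assign (.const 0) (pathTerm (k + 1)) (pathTerm (k + 2))⟩ ∧
    trigSeq (4 * k + 2) = ⟨createRule, assign (pathTerm (k + 1)) (pathTerm (k + 2)) (.const 0)⟩ ∧
    trigSeq (4 * k + 3) =
      ⟨backwardRule, assign (.const 0) (pathTerm (k + 1)) (pathTerm (k + 2))⟩ ∧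
    trigSeq (4 * k + 4) =
      ⟨collectRule, assign (.const 0) (pathTerm (k + 2)) (pathTerm (k + 1))⟩ := by
  have e0 : (4 * k) % 4 = 0 ∧ (4 * k) / 4 = k := by omega
  have e1 : (4 * k + 1) % 4 = 1 ∧ (4 * k + 1) / 4 = k := by omega
  have e2 : (4 * k + 2) % 4 = 2 ∧ (4 * k + 2) / 4 = k := by omega
  have e3 : (4 * k + 3) % 4 = 3 ∧ (4 * k + 3) / 4 = k := by omega
  simp only [trigSeq, e0, e1, e2, e3, and_self]

theorem mem_fbSeq {i : ℕ} {a : Atom} : a ∈ fbSeq i ↔ ∃ j ≤ i, atomSeq j = a := by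
  simp [fbSeq]

theorem pathP_forward_mem {i : ℕ} (k : ℕ) (h : 4 * k ≤ i + 2) : pathP k (k + 1) ∈ fbSeq i := by
  rw [mem_fbSeq]
  match k with
  | 0 => exact ⟨0, by omega, rfl⟩
  | k + 1 => exact ⟨4 * k + 2, by omega, (atomSeq_block k).1⟩

theorem pathX_forward_mem {i : ℕ} (k : ℕ) (hi : 1 ≤ i) (h : 4 * k ≤ i + 1) :
    pathX (k + 1) (k + 2) ∈ fbSeq i := by
  rw [mem_fbSeq]
  match k with
  | 0 => exact ⟨1, by omega, rfl⟩
  | k + 1 => exact ⟨4 * k + 3, by omega, (atomSeq_block k).2.1⟩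

theorem pathP_backward_mem {i : ℕ} (k : ℕ) (h : 4 * k + 4 ≤ i) :
    pathP (k + 2) (k + 1) ∈ fbSeq i :=
  mem_fbSeq.2 ⟨_, h, (atomSeq_block k).2.2.1⟩

theorem pathX_backward_mem {i : ℕ} (k : ℕ) (h : 4 * k + 5 ≤ i) :
    pathX (k + 2) (k + 1) ∈ fbSeq i :=
  mem_fbSeq.2 ⟨_, h, (atomSeq_block k).2.2.2⟩

theorem atomSeq_cases (j : ℕ) :
    (∃ k, atomSeq j = pathP k (k + 1) ∧ 4 * k ≤ j + 2) ∨
    (∃ k, atomSeq j = pathX (k + 1) (k + 2) ∧ 4 * k ≤ j + 1 ∧ 1 ≤ j) ∨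
    (∃ k, atomSeq j = pathP (k + 2) (k + 1) ∧ 4 * k + 4 ≤ j) ∨
    (∃ k, atomSeq j = pathX (k + 2) (k + 1) ∧ 4 * k + 5 ≤ j) := by
  rcases block_cases j with rfl | rfl | ⟨k, rfl | rfl | rfl | rfl⟩
  · exact .inl ⟨0, rfl, by omega⟩
  · exact .inr (.inl ⟨0, rfl, by omega⟩)
  · exact .inl ⟨k + 1, (atomSeq_block k).1, by omega⟩
  · exact .inr (.inl ⟨k + 1, (atomSeq_block k).2.1, by omega⟩)
  · exact .inr (.inr (.inl ⟨k, (atomSeq_block k).2.2.1, by omega⟩))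
  · exact .inr (.inr (.inr ⟨k, (atomSeq_block k).2.2.2, by omega⟩))

theorem mem_fbSeq_cases {i : ℕ} {a : Atom} (h : a ∈ fbSeq i) :
    (∃ k, a = pathP k (k + 1) ∧ 4 * k ≤ i + 2) ∨
    (∃ k, a = pathX (k + 1) (k + 2) ∧ 4 * k ≤ i + 1 ∧ 1 ≤ i) ∨
    (∃ k, a = pathP (k + 2) (k + 1) ∧ 4 * k + 4 ≤ i) ∨
    (∃ k, a = pathX (k + 2) (k + 1) ∧ 4 * k + 5 ≤ i) := by
  obtain ⟨j, hj, rfl⟩ := mem_fbSeq.1 h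
  rcases atomSeq_cases j with ⟨k, h, h'⟩ | ⟨k, h, h'⟩ | ⟨k, h, h'⟩ | ⟨k, h, h'⟩
  · exact .inl ⟨k, h, by omega⟩
  · exact .inr (.inl ⟨k, h, by omega⟩)
  · exact .inr (.inr (.inl ⟨k, h, by omega⟩))
  · exact .inr (.inr (.inr ⟨k, h, by omega⟩))

theorem mem_pathP_cases {i : ℕ} {s t : Term} (h : aP s t ∈ fbSeq i) :
    (∃ k, s = pathTerm k ∧ t = pathTerm (k + 1) ∧ 4 * k ≤ i + 2) ∨
    (∃ k, s = pathTerm (k + 2) ∧ t = pathTerm (k + 1) ∧ 4 * k + 4 ≤ i) := by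
  rcases mem_fbSeq_cases h with ⟨k, h, h'⟩ | ⟨k, h, h'⟩ | ⟨k, h, h'⟩ | ⟨k, h, h'⟩
  · exact .inl ⟨k, (aP_inj.1 h).1, (aP_inj.1 h).2, h'⟩
  · exact absurd h aP_ne_aX
  · exact .inr ⟨k, (aP_inj.1 h).1, (aP_inj.1 h).2, h'⟩
  · exact absurd h aP_ne_aX

theorem mem_pathX_cases {i : ℕ} {s t : Term} (h : aX s t ∈ fbSeq i) :
    (∃ k, s = pathTerm (k + 1) ∧ t = pathTerm (k + 2) ∧ 4 * k ≤ i + 1 ∧ 1 ≤ i) ∨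
    (∃ k, s = pathTerm (k + 2) ∧ t = pathTerm (k + 1) ∧ 4 * k + 5 ≤ i) := by
  rcases mem_fbSeq_cases h with ⟨k, h, h'⟩ | ⟨k, h, h'⟩ | ⟨k, h, h'⟩ | ⟨k, h, h'⟩
  · exact absurd h aP_ne_aX.symm
  · exact .inl ⟨k, (aX_inj.1 h).1, (aX_inj.1 h).2, h'⟩
  · exact absurd h aP_ne_aX.symm
  · exact .inr ⟨k, (aX_inj.1 h).1, (aX_inj.1 h).2, h'⟩

theorem args_of_mem_fbSeq {i : ℕ} {a : Atom} (h : a ∈ fbSeq i) {t : Term} (ht : t ∈ a.args) :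
    ∃ n, t = pathTerm n := by
  rcases mem_fbSeq_cases h with ⟨k, rfl, -⟩ | ⟨k, rfl, -⟩ | ⟨k, rfl, -⟩ | ⟨k, rfl, -⟩ <;>
  · simp only [pathP, pathX, aP, aX, List.mem_cons, List.not_mem_nil, or_false] at ht
    rcases ht with rfl | rfl <;> exact ⟨_, rfl⟩

theorem out_trigSeq (i : ℕ) : (trigSeq i).out = {atomSeq (i + 1)} := by
  rcases block_cases (i + 1) with h | h | ⟨k, h⟩
  · omega
  · obtain rfl : i = 0 := by omega
    exact out_createRule rfl
  · rcases h with h | h | h | h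
    · obtain rfl : i = 4 * k + 1 := by omega
      rw [(trigSeq_block k).1, (atomSeq_block k).1]
      exact out_forwardRule rfl
    · obtain rfl : i = 4 * k + 2 := by omega
      rw [(trigSeq_block k).2.1, (atomSeq_block k).2.1]
      exact out_createRule rfl
    · obtain rfl : i = 4 * k + 3 := by omega
      rw [(trigSeq_block k).2.2.1, (atomSeq_block k).2.2.1]
      exact out_backwardRule rfl
    · obtain rfl : i = 4 * k + 4 := by omega
      rw [(trigSeq_block k).2.2.2, (atomSeq_block k).2.2.2]
      exact out_collectRule rfl

theorem trigSeq_rule_mem_and_isOn (i : ℕ) :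
    (trigSeq i).rule ∈ twoAd R0set ∧ (trigSeq i).IsOn (fbSeq i) := by
  rw [mem_twoAd_R0set]
  rcases block_cases (i + 1) with h | h | ⟨k, h⟩
  · omega
  · obtain rfl : i = 0 := by omega
    exact ⟨.inl rfl, (isOn_createRule rfl).2 (pathP_forward_mem 0 (by omega))⟩
  · rcases h with h | h | h | h
    · obtain rfl : i = 4 * k + 1 := by omega
      rw [(trigSeq_block k).1]
      exact ⟨.inr (.inl rfl), (isOn_forwardRule rfl).2
        (pathX_forward_mem k (by omega) (by omega))⟩
    · obtain rfl : i = 4 * k + 2 := by omega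
      rw [(trigSeq_block k).2.1]
      exact ⟨.inl rfl, (isOn_createRule rfl).2 (pathP_forward_mem (k + 1) (by omega))⟩
    · obtain rfl : i = 4 * k + 3 := by omega
      rw [(trigSeq_block k).2.2.1]
      exact ⟨.inr (.inr (.inl rfl)), (isOn_backwardRule rfl).2
        (pathX_forward_mem k (by omega) (by omega))⟩
    · obtain rfl : i = 4 * k + 4 := by omega
      rw [(trigSeq_block k).2.2.2]
      exact ⟨.inr (.inr (.inr rfl)), (isOn_collectRule rfl).2
        ⟨pathP_backward_mem k (by omega), pathP_forward_mem (k + 1) (by omega)⟩⟩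

theorem applicable_trigSeq (i : ℕ) : Applicable .R (trigSeq i) (fbSeq i) := by
  rintro ⟨σ, hσ⟩
  have himg : (atomSeq (i + 1)).subst σ ∈ fbSeq i :=
    hσ.1 _ (by rw [out_trigSeq]; simp)
  have hfixP : ∀ k, 4 * k ≤ i + 2 → applyTerm σ (pathTerm k) = pathTerm k ∧
      applyTerm σ (pathTerm (k + 1)) = pathTerm (k + 1) := fun k hk =>
    ⟨hσ.applyTerm_eq (pathP_forward_mem k hk) (by simp [pathP, aP]),
      hσ.applyTerm_eq (pathP_forward_mem k hk) (by simp [pathP, aP])⟩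
  have hfixX : ∀ k, 1 ≤ i → 4 * k ≤ i + 1 →
      applyTerm σ (pathTerm (k + 2)) = pathTerm (k + 2) := fun k hi hk =>
    hσ.applyTerm_eq (pathX_forward_mem k hi hk) (by simp [pathX, aX])
  rcases block_cases (i + 1) with h | h | ⟨k, h⟩
  · omega
  · obtain rfl : i = 0 := by omega
    rcases mem_pathX_cases (s := applyTerm σ (pathTerm 1)) himg with ⟨k, _, _, h⟩ | ⟨k, _, _, h⟩ <;>
      omega
  · rcases h with h | h | h | h
    · obtain rfl : i = 4 * k + 1 := by omega
      rw [(atomSeq_block k).1, pathP, subst_aP, (hfixP k (by omega)).2,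
        hfixX k (by omega) (by omega)] at himg
      rcases mem_pathP_cases himg with ⟨l, h1, h2, h⟩ | ⟨l, h1, h2, h⟩ <;>
        rw [pathTerm_eq] at h1 h2 <;> omega
    · obtain rfl : i = 4 * k + 2 := by omega
      rw [(atomSeq_block k).2.1, pathX, subst_aX, (hfixP (k + 1) (by omega)).2] at himg
      rcases mem_pathX_cases himg with ⟨l, h1, h2, h⟩ | ⟨l, h1, h2, h⟩ <;>
        rw [pathTerm_eq] at h1 <;> omega
    · obtain rfl : i = 4 * k + 3 := by omega
      rw [(atomSeq_block k).2.2.1, pathP, subst_aP, (hfixP (k + 1) (by omega)).2,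
        (hfixP (k + 1) (by omega)).1] at himg
      rcases mem_pathP_cases himg with ⟨l, h1, h2, h⟩ | ⟨l, h1, h2, h⟩ <;>
        rw [pathTerm_eq] at h1 h2 <;> omega
    · obtain rfl : i = 4 * k + 4 := by omega
      rw [(atomSeq_block k).2.2.2, pathX, subst_aX, (hfixP (k + 1) (by omega)).2,
        (hfixP (k + 1) (by omega)).1] at himg
      rcases mem_pathX_cases himg with ⟨l, h1, h2, h⟩ | ⟨l, h1, h2, h⟩ <;>
        rw [pathTerm_eq] at h1 h2 <;> omega

/-- A trigger of the creating rule is satisfied once its frontier term has a successor. -/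
theorem not_applicable_createRule {t : Trigger} (h : t.rule = createRule) {j k : ℕ}
    (hy : t.map 1 = pathTerm (k + 1)) (hk : pathX (k + 1) (k + 2) ∈ fbSeq j) :
    ¬ Applicable .R t (fbSeq j) := by
  have hfix : ∀ v ∈ setVars (↑(fbSeq j) : Set Atom),
      Function.update Term.var (t.freshVar 2) (pathTerm (k + 2)) v = Term.var v := by
    rintro v ⟨a, ha, hv⟩
    by_cases e : v = t.freshVar 2
    · subst e
      rw [Function.update_self]
      obtain ⟨n, hn⟩ := args_of_mem_fbSeq ha (Atom.mem_vars.1 hv)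
      match n with
      | 0 => simp [pathTerm] at hn
      | 1 => simp [pathTerm] at hn
      | n + 2 =>
        rw [hn, pathTerm_eq]
        simp only [pathTerm, Term.var.injEq] at hn
        have h1 := (Trigger.freshVar_inj hn).2 1 (by rw [h, vars_createRule_body]; simp)
        rw [hy] at h1
        have := pathTerm_injective (a₂ := n + 1) h1
        omega
    · exact Function.update_of_ne e _ _
  refine not_applicable_of_subst _ hfix fun a ha => ?_
  rw [out_createRule h, Finset.mem_singleton] at ha
  have hy' : applyTerm (Function.update Term.var (t.freshVar 2) (pathTerm (k + 2)))
      (pathTerm (k + 1)) = pathTerm (k + 1) := by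
    cases hm : pathTerm (k + 1) with
    | const c => rfl
    | var v => exact hfix v ⟨_, hk, Atom.mem_vars.2 (by simp [pathX, aX, hm])⟩
  rw [ha, subst_aX, hy, hy', applyTerm, Function.update_self]
  exact hk

theorem eventually_not_applicable {t : Trigger} (ht : t.rule ∈ twoAd R0set) {i : ℕ}
    (hon : t.IsOn (fbSeq i)) : ∃ j > i, ¬ Applicable .R t (fbSeq j) := by
  refine ⟨4 * i + 100, by omega, ?_⟩
  rcases mem_twoAd_R0set.1 ht with h | h | h | h
  · rw [isOn_createRule h] at hon
    rcases mem_pathP_cases hon with ⟨k, h1, h2, h3⟩ | ⟨k, h1, h2, h3⟩ <;>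
      exact not_applicable_createRule h h2 (pathX_forward_mem k (by omega) (by omega))
  · rw [isOn_forwardRule h] at hon
    refine not_applicable_of_out_subset ?_
    rw [out_forwardRule h, Finset.singleton_subset_iff]
    rcases mem_pathX_cases hon with ⟨k, h1, h2, h3⟩ | ⟨k, h1, h2, h3⟩ <;> rw [h1, h2]
    · exact pathP_forward_mem (k + 1) (by omega)
    · exact pathP_backward_mem k (by omega)
  · rw [isOn_backwardRule h] at hon
    refine not_applicable_of_out_subset ?_
    rw [out_backwardRule h, Finset.singleton_subset_iff]
    rcases mem_pathX_cases hon with ⟨k, h1, h2, h3⟩ | ⟨k, h1, h2, h3⟩ <;> rw [h1, h2]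
    · exact pathP_backward_mem k (by omega)
    · exact pathP_forward_mem (k + 1) (by omega)
  · rw [isOn_collectRule h] at hon
    refine not_applicable_of_out_subset ?_
    rw [out_collectRule h, Finset.singleton_subset_iff]
    rcases mem_pathP_cases hon.1 with ⟨k, h1, h2, h3⟩ | ⟨k, h1, h2, h3⟩ <;> rw [h1, h2]
    · match k with
      | 0 =>
        have := hon.2
        rw [h1, h2] at this
        rcases mem_pathP_cases this with ⟨l, h1, h2, -⟩ | ⟨l, h1, h2, -⟩ <;>
          rw [pathTerm_eq] at h1 h2 <;> omega
      | k + 1 => exact pathX_forward_mem k (by omega) (by omega)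
    · exact pathX_backward_mem k (by omega)

/-- The infinite derivation from `⟨2ad(𝓡₀), {P(a,b)}⟩`. -/
def pathDerivation : Derivation (twoAd R0set) Fab where
  len := ⊤
  fb := fbSeq
  tr := trigSeq
  fb_zero := by simp [fbSeq, atomSeq, Fab, pathP, pathTerm]
  rule_mem i _ := (trigSeq_rule_mem_and_isOn i).1
  trig_on i _ := (trigSeq_rule_mem_and_isOn i).2
  trig_new i _ h := not_applicable_of_out_subset h (applicable_trigSeq i)
  fb_succ i _ := by
    rw [out_trigSeq, fbSeq, fbSeq, Finset.range_add_one (n := i + 1), Finset.image_insert,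
      Finset.insert_eq, Finset.union_comm]
  fb_stall i h := absurd (ENat.natCast_lt_top i) h

theorem pathDerivation_isX : pathDerivation.IsX .R := fun i _ => applicable_trigSeq i

theorem pathDerivation_fair : pathDerivation.Fair .R := fun _ _ _ ht hon _ =>
  have ⟨j, hj, h⟩ := eventually_not_applicable ht hon
  ⟨j, hj, le_top, h⟩

/-- The two-way atomic decomposition does not preserve
termination of the restricted chase: `𝓡₀ ∈ CT_R^∀` but `2ad(𝓡₀) ∉ CT_R^∀`;
in particular `⟨2ad(𝓡₀), {P(a,b)}⟩` admits an infinite fair R-derivation. -/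
theorem statement14 :
    CTall Variant.R R0set ∧ ¬ CTall Variant.R (twoAd R0set) ∧
    ∃ D : Derivation (twoAd R0set) Fab,
      D.IsX Variant.R ∧ D.Fair Variant.R ∧ D.len = ⊤ := by
  exact ⟨ctall_R0set, fun h => h Fab pathDerivation pathDerivation_isX pathDerivation_fair rfl,
    pathDerivation, pathDerivation_isX, pathDerivation_fair, rfl⟩

end
end ExRules
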